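/- arXiv:1907.03565 — 2 statements merged into one kernel-verified Lean document; each statement's English description precedes it below -/
import Mathlib

section
/- Let n ≥ 1 and k ≥ 1, let G be a simple graph on Fin n, let r ≥ 0, and let E_r be the r-th power digraph of G. Let I be a type having at least k+1 distinct elements. If for every set D of at most k vertices there exists a vertex v ∉ D such that no vertex of D has a walk of length at most r to v in G (i.e., E_r has no dominating set of size ≤ k), then no decision function f : (i : Fin n) → (Fin n → Option I) → I solves k-set agreement on E_r. Consequently, in the LOCAL model on the network G, any algorithm solving k-set agreement needs strictly more than r rounds. -/
open Classical in
/-- The view of process `i` in the information-flow digraph `E` on input assignment `x`. -/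
noncomputable def view {V I : Type*} (E : V → V → Prop) (x : V → I) (i j : V) : Option I :=
  if j = i ∨ E j i then some (x j) else none

/-- A decision function `f` solves `k`-set agreement on the information-flow digraph `E`. -/
def SolvesSetAgreement {n : ℕ} {I : Type*} (k : ℕ) (E : Fin n → Fin n → Prop)
    (f : (i : Fin n) → (Fin n → Option I) → I) : Prop :=
  ∀ x : Fin n → I,
    (∀ i : Fin n, f i (view E x i) ∈ Set.range x) ∧
    (Set.range fun i : Fin n => f i (view E x i)).ncard ≤ k

/-- The `r`-th power digraph of a simple graph `G`: an arc from `u` to `v` iff `u ≠ v` and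
there is a walk of length at most `r` from `u` to `v` in `G`. This is the information-flow
digraph of an `r`-round execution in the LOCAL model over the network `G`. -/
def powerDigraph {n : ℕ} (G : SimpleGraph (Fin n)) (r : ℕ) : Fin n → Fin n → Prop :=
  fun u v => u ≠ v ∧ ∃ w : G.Walk u v, w.length ≤ r

section ProductCells

open Finset

variable {n K : ℕ}

/-- The face of the product cell `c` obtained by deleting the value `a` at coordinate `i`. -/
def cellFace (c : Fin n → Finset (Fin K)) (i : Fin n) (a : Fin K) : Fin n → Finset (Fin K) :=
  fun j => (c j).filter fun b => ¬ (j = i ∧ b = a)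

lemma mem_cellFace {c : Fin n → Finset (Fin K)} {i j : Fin n} {a b : Fin K} :
    b ∈ cellFace c i a j ↔ b ∈ c j ∧ ¬ (j = i ∧ b = a) := by
  simp [cellFace]

lemma cellFace_subset (c : Fin n → Finset (Fin K)) (i : Fin n) (a : Fin K) (j : Fin n) :
    cellFace c i a j ⊆ c j :=
  filter_subset _ _

lemma cellFace_comm (c : Fin n → Finset (Fin K)) (i j : Fin n) (a b : Fin K) :
    cellFace (cellFace c i a) j b = cellFace (cellFace c j b) i a := by
  funext l
  ext d
  simp only [mem_cellFace]
  tauto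

lemma cellFace_cons_zero (s : Finset (Fin K)) (c : Fin n → Finset (Fin K)) (a : Fin K) :
    cellFace (Fin.cons s c : Fin (n + 1) → Finset (Fin K)) 0 a = Fin.cons (s.erase a) c := by
  funext l
  ext d
  refine Fin.cases ?_ (fun l => ?_) l <;> simp [mem_cellFace, and_comm]

lemma cellFace_cons_succ (s : Finset (Fin K)) (c : Fin n → Finset (Fin K)) (i : Fin n)
    (a : Fin K) :
    cellFace (Fin.cons s c : Fin (n + 1) → Finset (Fin K)) i.succ a =
      Fin.cons s (cellFace c i a) := by
  funext l
  ext d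
  refine Fin.cases ?_ (fun l => ?_) l
  · simp [mem_cellFace, (Fin.succ_ne_zero i).symm]
  · simp [mem_cellFace]

/-- The mod 2 coboundary of a function on product cells. -/
def cellCoboundary (φ : (Fin n → Finset (Fin K)) → ZMod 2) (c : Fin n → Finset (Fin K)) :
    ZMod 2 :=
  ∑ i, ∑ a ∈ c i, φ (cellFace c i a)

lemma cellCoboundary_add (φ χ : (Fin n → Finset (Fin K)) → ZMod 2) (c : Fin n → Finset (Fin K)) :
    cellCoboundary (fun d => φ d + χ d) c = cellCoboundary φ c + cellCoboundary χ c := by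
  simp [cellCoboundary, sum_add_distrib]

lemma cellCoboundary_cons (φ : (Fin (n + 1) → Finset (Fin K)) → ZMod 2) (s : Finset (Fin K))
    (c : Fin n → Finset (Fin K)) :
    cellCoboundary φ (Fin.cons s c) =
      ∑ a ∈ s, φ (Fin.cons (s.erase a) c) + cellCoboundary (fun d => φ (Fin.cons s d)) c := by
  simp [cellCoboundary, Fin.sum_univ_succ, cellFace_cons_zero, cellFace_cons_succ]

lemma sum_sum_eq_zero_of_symm {Q : Type*} [Fintype Q] (T : Q → Q → ZMod 2)
    (hsymm : ∀ p q, T p q = T q p) (hdiag : ∀ q, T q q = 0) : ∑ p, ∑ q, T p q = 0 := by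
  classical
  rw [← Fintype.sum_prod_type']
  refine sum_involution (fun p _ => p.swap) ?_ ?_ (fun _ _ => mem_univ _) (fun _ _ => rfl)
  · rintro ⟨p, q⟩ -
    simp only [Prod.swap_prod_mk, hsymm q p]
    exact CharTwo.add_self_eq_zero _
  · rintro ⟨p, q⟩ - h h'
    have hpq : q = p := congrArg Prod.fst h'
    exact h (hpq ▸ hdiag q)

lemma cellCoboundary_eq_sum_ite (φ : (Fin n → Finset (Fin K)) → ZMod 2)
    (c : Fin n → Finset (Fin K)) :
    cellCoboundary φ c =
      ∑ q : Fin n × Fin K, if q.2 ∈ c q.1 then φ (cellFace c q.1 q.2) else 0 := by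
  simp [cellCoboundary, Fintype.sum_prod_type, sum_ite_mem]

lemma cellCoboundary_cellCoboundary (φ : (Fin n → Finset (Fin K)) → ZMod 2)
    (c : Fin n → Finset (Fin K)) : cellCoboundary (cellCoboundary φ) c = 0 := by
  have h : cellCoboundary (cellCoboundary φ) c = ∑ p : Fin n × Fin K, ∑ q : Fin n × Fin K,
      if p.2 ∈ c p.1 ∧ q.2 ∈ cellFace c p.1 p.2 q.1 then
        φ (cellFace (cellFace c p.1 p.2) q.1 q.2) else 0 := by
    rw [cellCoboundary_eq_sum_ite]
    refine sum_congr rfl fun p _ => ?_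
    split_ifs with hp
    · simp [cellCoboundary_eq_sum_ite, hp]
    · simp [hp]
  rw [h]
  apply sum_sum_eq_zero_of_symm
  · intro p q
    rw [cellFace_comm]
    refine if_congr ?_ rfl rfl
    simp only [mem_cellFace]
    grind
  · intro q
    simp [mem_cellFace]

/-- The sum of `φ` over the cells `J ∩ [p₀, p₁] × ⋯ × J ∩ [pₙ₋₁, pₙ]` of the iterated
Alexander-Whitney diagonal of the simplex `J`. -/
def diagonalSum : (n : ℕ) → Finset (Fin K) → ((Fin n → Finset (Fin K)) → ZMod 2) → ZMod 2
  | 0, J, φ => if J.card = 1 then φ Fin.elim0 else 0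
  | n + 1, J, φ => ∑ p ∈ J, diagonalSum n (J.filter (p ≤ ·))
      fun c => φ (Fin.cons (J.filter (· ≤ p)) c)

lemma diagonalSum_add (J : Finset (Fin K)) (φ χ : (Fin n → Finset (Fin K)) → ZMod 2) :
    diagonalSum n J (fun c => φ c + χ c) = diagonalSum n J φ + diagonalSum n J χ := by
  induction n generalizing J with
  | zero => simp only [diagonalSum]; split_ifs <;> simp
  | succ n ih => simp only [diagonalSum, ih, sum_add_distrib]

lemma diagonalSum_zero (J : Finset (Fin K)) :
    diagonalSum n J (fun _ => 0) = 0 := by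
  induction n generalizing J with
  | zero => simp [diagonalSum]
  | succ n ih => simp [diagonalSum, ih]

lemma diagonalSum_sum {α : Type*} (s : Finset α) (J : Finset (Fin K))
    (φ : α → (Fin n → Finset (Fin K)) → ZMod 2) :
    diagonalSum n J (fun c => ∑ a ∈ s, φ a c) = ∑ a ∈ s, diagonalSum n J (φ a) := by
  classical
  induction s using Finset.induction_on with
  | empty => simp [diagonalSum_zero]
  | insert a s ha ih => simp only [sum_insert ha, diagonalSum_add, ih]

lemma diagonalSum_empty (φ : (Fin n → Finset (Fin K)) → ZMod 2) :
    diagonalSum n ∅ φ = 0 := by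
  cases n <;> simp [diagonalSum]

lemma diagonalSum_singleton (j : Fin K) (φ : (Fin n → Finset (Fin K)) → ZMod 2) :
    diagonalSum n {j} φ = φ fun _ => {j} := by
  induction n with
  | zero =>
    simp only [diagonalSum, card_singleton, if_true]
    exact congrArg φ (Subsingleton.elim _ _)
  | succ n ih =>
    simp only [diagonalSum, sum_singleton, filter_singleton, le_refl, if_true, ih]
    congr 1
    funext i
    refine Fin.cases ?_ (fun i => ?_) i <;> simp

lemma card_filter_le_add_card_filter_ge (J : Finset (Fin K)) {p : Fin K} (hp : p ∈ J) :
    (J.filter (· ≤ p)).card + (J.filter (p ≤ ·)).card = J.card + 1 := by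
  rw [← card_union_add_card_inter, ← filter_or, ← filter_and]
  have h₁ : J.filter (fun a => a ≤ p ∨ p ≤ a) = J := filter_true_of_mem fun a _ => le_total a p
  have h₂ : J.filter (fun a => a ≤ p ∧ p ≤ a) = {p} := by
    ext a
    simp only [mem_filter, mem_singleton]
    grind
  rw [h₁, h₂, card_singleton]

lemma diagonalSum_eq_zero (J : Finset (Fin K)) (φ : (Fin n → Finset (Fin K)) → ZMod 2)
    (h : ∀ c : Fin n → Finset (Fin K), (∀ i, c i ⊆ J) → ∑ i, (c i).card + 1 = n + J.card →
      φ c = 0) :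
    diagonalSum n J φ = 0 := by
  induction n generalizing J with
  | zero =>
    simp only [diagonalSum]
    split_ifs with hJ
    · exact h _ (fun i => i.elim0) (by simp [hJ])
    · rfl
  | succ n ih =>
    refine sum_eq_zero fun p hp => ih _ _ fun c hc hcard => h _ ?_ ?_
    · intro i
      refine Fin.cases ?_ (fun i => ?_) i
      · simp
      · simpa using (hc i).trans (filter_subset _ _)
    · have := card_filter_le_add_card_filter_ge J hp
      simp only [Fin.sum_univ_succ, Fin.cons_zero, Fin.cons_succ]
      omega

lemma sum_cut_eq_zero (J : Finset (Fin K)) (W : Finset (Fin K) → Finset (Fin K) → ZMod 2)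
    (hl : ∀ X, W ∅ X = 0) (hr : ∀ X, W X ∅ = 0) :
    ∑ p ∈ J, (W (J.filter (· < p)) (J.filter (p ≤ ·)) +
      W (J.filter (· ≤ p)) (J.filter (p < ·))) = 0 := by
  set A : ℕ → ZMod 2 := fun m => W (J.filter (·.val < m)) (J.filter (m ≤ ·.val)) with hA
  have h₁ : ∀ p : Fin K, W (J.filter (· < p)) (J.filter (p ≤ ·)) = A p := fun p => rfl
  have h₂ : ∀ p : Fin K, W (J.filter (· ≤ p)) (J.filter (p < ·)) = A (p + 1) := fun p => by
    simp only [hA, Nat.lt_succ_iff, Nat.succ_le_iff, Fin.le_def, Fin.lt_def]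
  have h₃ : ∀ p : Fin K, p ∉ J → A p + A (p + 1) = 0 := fun p hp => by
    have hlt : J.filter (·.val < p.val + 1) = J.filter (·.val < p.val) := by
      refine filter_congr fun a ha => ?_
      have : a.val ≠ p.val := fun e => hp (Fin.ext e ▸ ha)
      omega
    have hle : J.filter (p.val + 1 ≤ ·.val) = J.filter (p.val ≤ ·.val) := by
      refine filter_congr fun a ha => ?_
      have : a.val ≠ p.val := fun e => hp (Fin.ext e ▸ ha)
      omega
    simp only [hA, hlt, hle]
    exact CharTwo.add_self_eq_zero _
  simp only [h₁, h₂]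
  rw [sum_subset (subset_univ J) fun p _ hp => h₃ p hp,
    Fin.sum_univ_eq_sum_range (fun m => A m + A (m + 1)) K]
  have h₄ : ∀ m, A m + A (m + 1) = A (m + 1) - A m := fun m => by
    rw [CharTwo.sub_eq_add, add_comm]
  simp only [h₄, sum_range_sub]
  have h₅ : J.filter (K ≤ ·.val) = ∅ := filter_false_of_mem fun a _ => not_le.2 a.2
  simp [hA, h₅, hl, hr]

lemma sum_erase_cut (J : Finset (Fin K)) (W : Finset (Fin K) → Finset (Fin K) → ZMod 2)
    (hl : ∀ X, W ∅ X = 0) (hr : ∀ X, W X ∅ = 0) :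
    ∑ p ∈ J, (∑ a ∈ J.filter (· ≤ p), W ((J.filter (· ≤ p)).erase a) (J.filter (p ≤ ·)) +
      ∑ a ∈ J.filter (p ≤ ·), W (J.filter (· ≤ p)) ((J.filter (p ≤ ·)).erase a)) =
    ∑ a ∈ J, ∑ p ∈ J.erase a, W ((J.erase a).filter (· ≤ p)) ((J.erase a).filter (p ≤ ·)) := by
  have key : ∀ p ∈ J,
      (∑ a ∈ J.filter (· ≤ p), W ((J.filter (· ≤ p)).erase a) (J.filter (p ≤ ·)) +
        ∑ a ∈ J.filter (p ≤ ·), W (J.filter (· ≤ p)) ((J.filter (p ≤ ·)).erase a)) =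
      (W (J.filter (· < p)) (J.filter (p ≤ ·)) + W (J.filter (· ≤ p)) (J.filter (p < ·))) +
        ∑ a ∈ J.erase p, W ((J.erase a).filter (· ≤ p)) ((J.erase a).filter (p ≤ ·)) := by
    intro p hp
    rw [sum_filter, sum_filter, ← sum_add_distrib, ← add_sum_erase _ _ hp]
    congr 1
    · have h₁ : (J.filter (· ≤ p)).erase p = J.filter (· < p) := by
        ext b; simp only [mem_erase, mem_filter]; grind
      have h₂ : (J.filter (p ≤ ·)).erase p = J.filter (p < ·) := by
        ext b; simp only [mem_erase, mem_filter]; grind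
      simp [h₁, h₂]
    · refine sum_congr rfl fun a ha => ?_
      rw [filter_erase, filter_erase]
      rcases lt_or_gt_of_ne (ne_of_mem_erase ha) with h | h
      · rw [if_pos h.le, if_neg h.not_ge, add_zero,
          erase_eq_of_notMem (s := J.filter (p ≤ ·)) (by simp [h])]
      · rw [if_neg h.not_ge, if_pos h.le, zero_add,
          erase_eq_of_notMem (s := J.filter (· ≤ p)) (by simp [h])]
  rw [sum_congr rfl key, sum_add_distrib, sum_cut_eq_zero J W hl hr, zero_add]
  refine sum_comm' fun a b => ?_
  simp only [mem_erase]
  grind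

lemma diagonalSum_cellCoboundary (J : Finset (Fin K)) (φ : (Fin n → Finset (Fin K)) → ZMod 2)
    (hφ : ∀ c i, c i = ∅ → φ c = 0) :
    diagonalSum n J (cellCoboundary φ) = ∑ j ∈ J, diagonalSum n (J.erase j) φ := by
  induction n generalizing J with
  | zero =>
    have h : ∀ j ∈ J, diagonalSum 0 (J.erase j) φ =
        if J.card - 1 = 1 then φ Fin.elim0 else 0 := fun j hj => by
      simp only [diagonalSum, card_erase_of_mem hj]
    rw [sum_congr rfl h, sum_const]
    simp only [diagonalSum, cellCoboundary, univ_eq_empty, sum_empty, ite_self]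
    split_ifs with hc
    · have : J.card = 2 := by omega
      rw [this, two_nsmul, CharTwo.add_self_eq_zero]
    · simp
  | succ n ih =>
    simp only [diagonalSum, cellCoboundary_cons, diagonalSum_add, diagonalSum_sum]
    rw [← sum_erase_cut J (fun X Y => diagonalSum n Y fun c => φ (Fin.cons X c))]
    · refine sum_congr rfl fun p _ => ?_
      rw [ih]
      exact fun c i hc => hφ _ i.succ (by simpa using hc)
    · intro X
      have : ∀ c : Fin n → Finset (Fin K), φ (Fin.cons ∅ c) = 0 := fun c => hφ _ 0 (by simp)
      simp only [this, diagonalSum_zero]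
    · exact fun X => diagonalSum_empty _

/-- The mod 2 coboundary of a function on simplices. -/
def simplexCoboundary (ψ : Finset (Fin K) → ZMod 2) (s : Finset (Fin K)) : ZMod 2 :=
  ∑ a ∈ s, ψ (s.erase a)

/-- The transpose of the operation coning a simplex off to the vertex `a`. -/
def coneDual (a : Fin K) (ψ : Finset (Fin K) → ZMod 2) (s : Finset (Fin K)) : ZMod 2 :=
  if a ∈ s then 0 else ψ (insert a s)

lemma coneDual_simplexCoboundary (a : Fin K) (ψ : Finset (Fin K) → ZMod 2) :
    coneDual a (simplexCoboundary ψ) = fun s => ψ s + simplexCoboundary (coneDual a ψ) s := by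
  funext s
  by_cases ha : a ∈ s
  · have h : simplexCoboundary (coneDual a ψ) s = ψ s := by
      rw [simplexCoboundary, sum_eq_single_of_mem a ha]
      · simp [coneDual, insert_erase ha]
      · intro b _ hb
        simp [coneDual, ha, hb.symm]
    rw [h, CharTwo.add_self_eq_zero]
    simp [coneDual, ha]
  · simp only [coneDual, if_neg ha, simplexCoboundary, sum_insert ha, erase_insert ha]
    congr 1
    refine sum_congr rfl fun b hb => ?_
    have hab : a ≠ b := fun e => ha (e ▸ hb)
    rw [if_neg (fun h => ha (mem_of_mem_erase h)), erase_insert_of_ne hab]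

/-- The sum of `ψ` over the images under the vertex labelling `l` of the `m`-simplices of the
barycentric subdivision of the `m`-cell `c`. -/
def barycentricSum (l : (Fin n → Finset (Fin K)) → Fin K) :
    ℕ → (Finset (Fin K) → ZMod 2) → (Fin n → Finset (Fin K)) → ZMod 2
  | 0, ψ, c => if ∀ i, (c i).card = 1 then ψ {l c} else 0
  | m + 1, ψ, c => cellCoboundary (barycentricSum l m (coneDual (l c) ψ)) c

variable (l : (Fin n → Finset (Fin K)) → Fin K)

lemma barycentricSum_add (m : ℕ) (ψ χ : Finset (Fin K) → ZMod 2) :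
    barycentricSum l m (fun s => ψ s + χ s) =
      fun c => barycentricSum l m ψ c + barycentricSum l m χ c := by
  induction m generalizing ψ χ with
  | zero => funext c; simp only [barycentricSum]; split_ifs <;> simp
  | succ m ih =>
    funext c
    have h : coneDual (l c) (fun s => ψ s + χ s) =
        fun s => coneDual (l c) ψ s + coneDual (l c) χ s := by
      funext s
      simp only [coneDual]
      split_ifs <;> simp
    simp only [barycentricSum, h, ih, cellCoboundary_add]

lemma barycentricSum_eq_zero_of_empty (m : ℕ) (ψ : Finset (Fin K) → ZMod 2)
    (c : Fin n → Finset (Fin K)) (i : Fin n) (hc : c i = ∅) : barycentricSum l m ψ c = 0 := by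
  induction m generalizing ψ c with
  | zero =>
    rw [barycentricSum, if_neg]
    intro h
    simpa [hc] using h i
  | succ m ih =>
    rw [barycentricSum, cellCoboundary]
    refine sum_eq_zero fun j _ => sum_eq_zero fun a _ => ih _ _ ?_
    simp [cellFace, hc]

lemma cellCoboundary_vertexIndicator (t : ZMod 2) (c : Fin n → Finset (Fin K)) :
    cellCoboundary (fun d => if ∀ i, (d i).card = 1 then t else 0) c = 0 := by
  refine sum_eq_zero fun i _ => ?_
  have h : ∀ a ∈ c i, (if ∀ j, (cellFace c i a j).card = 1 then t else 0) =
      if (c i).card = 2 ∧ ∀ j ≠ i, (c j).card = 1 then t else 0 := by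
    intro a ha
    have h₁ : cellFace c i a i = (c i).erase a := by
      ext b; simp [mem_cellFace, and_comm]
    have h₂ : ∀ j ≠ i, cellFace c i a j = c j := fun j hj => by
      ext b; simp [mem_cellFace, hj]
    have hpos : 0 < (c i).card := card_pos.2 ⟨a, ha⟩
    refine if_congr ⟨fun h => ⟨?_, fun j hj => h₂ j hj ▸ h j⟩, fun h j => ?_⟩ rfl rfl
    · have := h i
      rw [h₁, card_erase_of_mem ha] at this
      omega
    · by_cases hj : j = i
      · subst hj
        rw [h₁, card_erase_of_mem ha, h.1]
      · rw [h₂ j hj]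
        exact h.2 j hj
  rw [sum_congr rfl h, sum_const]
  split_ifs with hc
  · rw [hc.1, two_nsmul, CharTwo.add_self_eq_zero]
  · simp

lemma barycentricSum_simplexCoboundary (m : ℕ) (ψ : Finset (Fin K) → ZMod 2) :
    barycentricSum l (m + 1) (simplexCoboundary ψ) = cellCoboundary (barycentricSum l m ψ) := by
  induction m generalizing ψ with
  | zero =>
    funext c
    rw [barycentricSum, coneDual_simplexCoboundary, barycentricSum_add, cellCoboundary_add]
    have h : barycentricSum l 0 (simplexCoboundary (coneDual (l c) ψ)) =
        fun d => if ∀ i, (d i).card = 1 then coneDual (l c) ψ ∅ else 0 := by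
      funext d
      simp [barycentricSum, simplexCoboundary]
    rw [h, cellCoboundary_vertexIndicator, add_zero]
  | succ m ih =>
    funext c
    rw [barycentricSum, coneDual_simplexCoboundary, barycentricSum_add, cellCoboundary_add, ih,
      cellCoboundary_cellCoboundary, add_zero]

lemma barycentricSum_eq_zero (S : (Fin n → Fin K) → Finset (Fin K)) (m : ℕ)
    (ψ : Finset (Fin K) → ZMod 2) (c : Fin n → Finset (Fin K))
    (hl : ∀ d : Fin n → Finset (Fin K), (∀ i, d i ⊆ c i) → ∀ x : Fin n → Fin K,
      (∀ i, x i ∈ d i) → l d ∈ S x)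
    (hψ : ∀ s (x : Fin n → Fin K), s.card = m + 1 → (∀ i, x i ∈ c i) → s ⊆ S x → ψ s = 0) :
    barycentricSum l m ψ c = 0 := by
  induction m generalizing ψ c with
  | zero =>
    rw [barycentricSum]
    split_ifs with h
    · have hx : ∀ i, ∃ a, a ∈ c i := fun i => card_pos.1 (by simp [h i])
      choose x hx using hx
      exact hψ _ x (by simp) hx (by simpa using hl c (fun _ => Subset.rfl) x hx)
    · rfl
  | succ m ih =>
    rw [barycentricSum, cellCoboundary]
    refine sum_eq_zero fun i _ => sum_eq_zero fun a _ => ih _ _ ?_ ?_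
    · exact fun d hd => hl d fun j => (hd j).trans (cellFace_subset c i a j)
    · intro s x hs hx hsx
      have hxc : ∀ j, x j ∈ c j := fun j => cellFace_subset c i a j (hx j)
      rw [coneDual]
      split_ifs with hmem
      · rfl
      · refine hψ _ x (by rw [card_insert_of_notMem hmem, hs]) hxc ?_
        exact insert_subset (hl c (fun _ => Subset.rfl) x hxc) hsx

lemma diagonalSum_barycentricSum (S : (Fin n → Fin K) → Finset (Fin K))
    (hS : ∀ x, S x ⊆ univ.image x)
    (hl : ∀ c : Fin n → Finset (Fin K), ∑ i, (c i).card + 1 ≤ n + K →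
      ∀ x : Fin n → Fin K, (∀ i, x i ∈ c i) → l c ∈ S x)
    (m : ℕ) (J : Finset (Fin K)) (hJ : J.card = m + 1) (ψ : Finset (Fin K) → ZMod 2) :
    diagonalSum n J (barycentricSum l m ψ) = ψ J := by
  induction m generalizing J ψ with
  | zero =>
    obtain ⟨j, rfl⟩ := card_eq_one.1 hJ
    have hK : 0 < K := j.pos
    have hmem := hS _ (hl (fun _ => {j}) (by simp; omega) (fun _ => j) (by simp))
    obtain ⟨_, -, hj⟩ := mem_image.1 hmem
    rw [diagonalSum_singleton, barycentricSum, if_pos (by simp), ← hj]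
  | succ m ih =>
    have vanish : ∀ χ : Finset (Fin K) → ZMod 2, χ J = 0 →
        diagonalSum n J (barycentricSum l (m + 1) χ) = 0 := by
      intro χ hχ
      refine diagonalSum_eq_zero _ _ fun c hcJ hcard => barycentricSum_eq_zero l S _ _ _ ?_ ?_
      · intro d hd
        refine hl d ?_
        have h₁ : ∑ i, (d i).card ≤ ∑ i, (c i).card := sum_le_sum fun i _ => card_le_card (hd i)
        have h₂ : J.card ≤ K := by simpa using card_le_univ J
        omega
      · intro s x hs hx hsx
        have hsJ : s ⊆ J := fun a ha => by
          obtain ⟨i, -, rfl⟩ := mem_image.1 (hS x (hsx ha))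
          exact hcJ i (hx i)
        rw [eq_of_subset_of_card_le hsJ (by omega), hχ]
    obtain ⟨j, hj⟩ : J.Nonempty := card_pos.1 (by omega)
    set χ : Finset (Fin K) → ZMod 2 := fun s => if s = J.erase j then ψ J else 0 with hχ
    have hsum : ∑ a ∈ J, χ (J.erase a) = ψ J := by
      rw [sum_eq_single_of_mem j hj]
      · simp [hχ]
      · intro a ha haj
        refine if_neg fun h => ?_
        exact haj ((erase_injOn J) ha hj h)
    have h₁ : diagonalSum n J (barycentricSum l (m + 1) (simplexCoboundary χ)) = ψ J := by
      rw [barycentricSum_simplexCoboundary, diagonalSum_cellCoboundary _ _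
        (fun c i => barycentricSum_eq_zero_of_empty l m χ c i), ← hsum]
      refine sum_congr rfl fun a ha => ih _ ?_ _
      rw [card_erase_of_mem ha, hJ]
      rfl
    have h₂ := vanish (fun s => ψ s + simplexCoboundary χ s) (by
      rw [simplexCoboundary, hsum, CharTwo.add_self_eq_zero])
    rw [barycentricSum_add, diagonalSum_add, h₁] at h₂
    exact CharTwo.add_eq_zero.1 h₂

/-- If every set of at most `k` coordinates is ignored by some process and every process decides
on an input value, then all `k + 1` values are decided on some input assignment. -/
lemma exists_forall_exists_decide_eq {n k : ℕ}
    (dec : Fin n → (Fin n → Fin (k + 1)) → Fin (k + 1))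
    (hval : ∀ i x, ∃ j, x j = dec i x)
    (hdec : ∀ D : Finset (Fin n), D.card ≤ k → ∃ v, ∀ x y : Fin n → Fin (k + 1),
      (∀ j ∉ D, x j = y j) → dec v x = dec v y) :
    ∃ x, ∀ a, ∃ i, dec i x = a := by
  have hex : ∀ c : Fin n → Finset (Fin (k + 1)), ∃ a, ∑ i, (c i).card + 1 ≤ n + (k + 1) →
      ∀ x : Fin n → Fin (k + 1), (∀ i, x i ∈ c i) → a ∈ univ.image fun i => dec i x := by
    intro c
    by_cases h : ∑ i, (c i).card + 1 ≤ n + (k + 1) ∧ ∀ i, (c i).Nonempty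
    · obtain ⟨hcard, hne⟩ := h
      choose y hy using hne
      have hD : (univ.filter fun i => 1 < (c i).card).card ≤ k := by
        have h₁ : ∑ i, (1 + if 1 < (c i).card then 1 else 0) ≤ ∑ i, (c i).card := by
          refine sum_le_sum fun i _ => ?_
          have := card_pos.2 ⟨y i, hy i⟩
          split_ifs <;> omega
        rw [sum_add_distrib, ← card_filter] at h₁
        simp only [sum_const, card_univ, Fintype.card_fin, smul_eq_mul, mul_one] at h₁
        omega
      obtain ⟨v, hv⟩ := hdec _ hD
      refine ⟨dec v y, fun _ x hx => mem_image.2 ⟨v, mem_univ _, hv _ _ fun j hj => ?_⟩⟩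
      exact card_le_one.1 (by simpa using hj) _ (hx j) _ (hy j)
    · refine ⟨0, fun hcard x hx => absurd ⟨hcard, fun i => ⟨x i, hx i⟩⟩ h⟩
  choose l hl using hex
  by_contra! hcon
  have hone := diagonalSum_barycentricSum l (fun x => univ.image fun i => dec i x)
    (fun x a ha => by
      obtain ⟨i, -, rfl⟩ := mem_image.1 ha
      obtain ⟨j, hj⟩ := hval i x
      exact mem_image.2 ⟨j, mem_univ _, hj⟩) hl k univ (by simp) (fun _ => 1)
  rw [diagonalSum_eq_zero] at hone
  · exact zero_ne_one hone
  intro c _ hcard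
  refine barycentricSum_eq_zero l (fun x => univ.image fun i => dec i x) _ _ _ ?_ ?_
  · intro d hd
    refine hl d ?_
    have h₁ : ∑ i, (d i).card ≤ ∑ i, (c i).card := sum_le_sum fun i _ => card_le_card (hd i)
    simp only [card_univ, Fintype.card_fin] at hcard
    omega
  · intro s x hs _ hsx
    obtain ⟨a, ha⟩ := hcon x
    have hsuniv : s = univ := (card_eq_iff_eq_univ s).1 (by simp [hs])
    obtain ⟨i, -, hi⟩ := mem_image.1 (hsx (hsuniv ▸ mem_univ a))
    exact absurd hi (ha i)

end ProductCells

/-- **Theorem (lower bound for k-set agreement in the LOCAL model).** If for every set `D` of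
at most `k` vertices there is a vertex `v ∉ D` that no vertex of `D` reaches by a walk of
length at most `r` (i.e. the `r`-th power digraph of `G` has no dominating set of size at
most `k`), then no decision function solves `k`-set agreement on the `r`-th power digraph;
hence any LOCAL algorithm solving `k`-set agreement on `G` requires more than `r` rounds. -/
theorem setAgreement_local_lower_bound {n k : ℕ} (hn : 1 ≤ n) (hk : 1 ≤ k)
    (G : SimpleGraph (Fin n)) (r : ℕ) {I : Type*}
    (hI : ∃ g : Fin (k + 1) → I, Function.Injective g)
    (hdom : ∀ D : Finset (Fin n), D.card ≤ k →
      ∃ v : Fin n, v ∉ D ∧ ∀ u ∈ D, ¬ ∃ w : G.Walk u v, w.length ≤ r) :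
    ∀ f : (i : Fin n) → (Fin n → Option I) → I,
      ¬ SolvesSetAgreement k (powerDigraph G r) f := by
  rintro f hf
  obtain ⟨g, hg⟩ := hI
  have hval : ∀ (i : Fin n) (x : Fin n → Fin (k + 1)), ∃ j,
      g (x j) = f i (view (powerDigraph G r) (g ∘ x) i) := fun i x => (hf (g ∘ x)).1 i
  choose w hw using hval
  obtain ⟨x, hx⟩ := exists_forall_exists_decide_eq (fun i x => x (w i x))
    (fun i x => ⟨w i x, rfl⟩) fun D hD => by
      obtain ⟨v, hvD, hv⟩ := hdom D hD
      refine ⟨v, fun x y hxy => hg ?_⟩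
      rw [hw, hw]
      congr 1
      funext j
      unfold view
      split_ifs with hj
      · have hjD : j ∉ D := fun hjD => by
          rcases hj with rfl | ⟨-, hj⟩
          · exact hvD hjD
          · exact hv j hjD hj
        simp [hxy j hjD]
      · rfl
  have hsub : Set.range g ⊆
      Set.range fun i : Fin n => f i (view (powerDigraph G r) (g ∘ x) i) := by
    rintro _ ⟨a, rfl⟩
    obtain ⟨i, rfl⟩ := hx a
    exact ⟨i, (hw i x).symm⟩
  have hle := (Set.ncard_le_ncard hsub (Set.finite_range _)).trans (hf (g ∘ x)).2
  rw [Set.ncard_range_of_injective hg, Nat.card_eq_fintype_card, Fintype.card_fin] at hle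
  omega
end

section
/- Let n ≥ 2, let G_1, …, G_r be a finite sequence of digraphs on Fin n, and let E_{≤r} be the information-flow digraph of the sequence (arcs given by temporal reachability within r rounds). If E_{≤r} has no universal node, then for every real ε with 0 ≤ ε < 1/(n−1), no decision function f : (i : Fin n) → (Fin n → Option Bool) → ℝ solves ε-approximate agreement on E_{≤r}. Consequently, in the dynamic network model, any algorithm solving ε-approximate agreement with ε < 1/(n−1) against an adversary that can produce the sequence G_1, …, G_r needs strictly more than r rounds. -/
/-- The encoding of Boolean values as reals: `χ(false) = 0`, `χ(true) = 1`. -/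
noncomputable def chi (b : Bool) : ℝ := if b then 1 else 0

/-- A decision function `f` solves `ε`-approximate agreement on the information-flow digraph
`E`. -/
def SolvesApproxAgreement {n : ℕ} (E : Fin n → Fin n → Prop) (ε : ℝ)
    (f : (i : Fin n) → (Fin n → Option Bool) → ℝ) : Prop :=
  ∀ x : Fin n → Bool,
    (∀ b : Bool, (∀ i : Fin n, x i = b) → ∀ i : Fin n, f i (view E x i) = chi b) ∧
    (∀ i j : Fin n, |f i (view E x i) - f j (view E x j)| ≤ ε)

/-- `u` temporally reaches `v` within `r` rounds of the dynamic graph sequence `Gs`. -/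
def TemporalReach {n : ℕ} (Gs : ℕ → Fin n → Fin n → Prop) (r : ℕ) (u v : Fin n) : Prop :=
  u = v ∨ ∃ (ℓ : ℕ) (w : ℕ → Fin n) (ts : ℕ → ℕ),
    1 ≤ ℓ ∧ w 0 = u ∧ w ℓ = v ∧
    (∀ m : ℕ, 1 ≤ m → m ≤ ℓ → 1 ≤ ts m ∧ ts m ≤ r) ∧
    (∀ m : ℕ, 1 ≤ m → m + 1 ≤ ℓ → ts m < ts (m + 1)) ∧
    (∀ m : ℕ, 1 ≤ m → m ≤ ℓ → Gs (ts m) (w (m - 1)) (w m))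

/-- The information-flow digraph of the first `r` rounds of the dynamic graph sequence `Gs`:
an arc from `u` to `v` iff `u ≠ v` and `u` temporally reaches `v` within `r` rounds. -/
def infoFlow {n : ℕ} (Gs : ℕ → Fin n → Fin n → Prop) (r : ℕ) : Fin n → Fin n → Prop :=
  fun u v => u ≠ v ∧ TemporalReach Gs r u v

/-- Views are unchanged when the input of an unheard process is modified. -/
theorem view_congr {V I : Type*} (E : V → V → Prop) {x y : V → I} {u v : V}
    (hvu : v ≠ u) (hE : ¬ E u v) (hxy : ∀ j, j ≠ u → x j = y j) : view E x v = view E y v := by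
  funext j
  unfold view
  by_cases h : j = u
  · subst h
    simp [hE, hvu.symm]
  · rw [hxy j h]

/-- If no node of `E` is universal, then on the assignment whose first `k + 1` inputs are `true`
and whose other inputs are `false`, some process decides at most `k * ε`. -/
theorem SolvesApproxAgreement.exists_le {n : ℕ} {E : Fin n → Fin n → Prop} {ε : ℝ}
    {f : (i : Fin n) → (Fin n → Option Bool) → ℝ} (hf : SolvesApproxAgreement E ε f)
    (hU : ¬ ∃ u : Fin n, ∀ v : Fin n, v = u ∨ E u v) (k : ℕ) (hk : k < n) :
    ∃ i : Fin n, f i (view E (fun j => decide (j.val < k + 1)) i) ≤ k * ε := by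
  push Not at hU
  obtain ⟨v, hvu, hE⟩ := hU ⟨k, hk⟩
  refine ⟨v, ?_⟩
  have hview : view E (fun j => decide (j.val < k + 1)) v =
      view E (fun j => decide (j.val < k)) v := by
    refine view_congr E hvu hE fun j hj => ?_
    have hj' : j.val ≠ k := fun h => hj (Fin.ext h)
    simp only [decide_eq_decide]
    omega
  rw [hview]
  cases k with
  | zero =>
    have h0 := (hf (fun j => decide (j.val < 0))).1 false (by simp) v
    rw [h0]
    simp [chi]
  | succ m =>
    obtain ⟨i, hi⟩ := hf.exists_le (by push Not; exact hU) m (by omega)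
    have h := (abs_le.mp ((hf (fun j => decide (j.val < m + 1))).2 v i)).2
    push_cast
    linarith

/-- If no node of `E` is universal, then `ε`-approximate agreement on `E` forces
`1 ≤ (n - 1) * ε`. -/
theorem SolvesApproxAgreement.one_le {n : ℕ} {E : Fin n → Fin n → Prop} {ε : ℝ}
    {f : (i : Fin n) → (Fin n → Option Bool) → ℝ} (hf : SolvesApproxAgreement E ε f)
    (hU : ¬ ∃ u : Fin n, ∀ v : Fin n, v = u ∨ E u v) (hn : 1 ≤ n) :
    1 ≤ ((n : ℝ) - 1) * ε := by
  obtain ⟨i, hi⟩ := hf.exists_le hU (n - 1) (by omega)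
  have h1 := (hf (fun j => decide (j.val < n - 1 + 1))).1 true
    (fun j => by simp only [decide_eq_true_eq]; omega) i
  rw [h1, Nat.cast_sub hn] at hi
  simpa [chi] using hi

/-- **Theorem (lower bound for approximate agreement in dynamic networks).** If the
information-flow digraph of the `r`-round dynamic graph sequence `Gs` has no universal node,
then for every `ε` with `0 ≤ ε < 1/(n-1)`, no decision function solves `ε`-approximate
agreement on it; hence any algorithm solving `ε`-approximate agreement against an adversary
that can produce `Gs` needs more than `r` rounds. -/
theorem approxAgreement_dynamic_lower_bound {n : ℕ} (hn : 2 ≤ n)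
    (r : ℕ) (Gs : ℕ → Fin n → Fin n → Prop)
    (hU : ¬ ∃ u : Fin n, ∀ v : Fin n, v = u ∨ infoFlow Gs r u v)
    (ε : ℝ) (hε0 : 0 ≤ ε) (hε : ε < 1 / ((n : ℝ) - 1)) :
    ∀ f : (i : Fin n) → (Fin n → Option Bool) → ℝ,
      ¬ SolvesApproxAgreement (infoFlow Gs r) ε f := by
  intro f hf
  have hn' : (2 : ℝ) ≤ n := by exact_mod_cast hn
  rw [lt_div_iff₀ (by linarith)] at hε
  have := hf.one_le hU (by omega)
  linarith
end
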